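/- arXiv:math/0602366 — 2 statements merged into one kernel-verified Lean document; each statement's English description precedes it below -/
import Mathlib

section
/- Let M = (M_j)_{j≥0} be a strongly regular sequence and let s > 0 be a real number. Then the growth index of the strongly regular sequence M^s = (M_j^s)_{j≥0} satisfies γ(M^s) = s · γ(M). -/
noncomputable section

open Filter MeasureTheory
open scoped Topology

def StronglyRegularWith (M : ℕ → ℝ) (A : ℝ) : Prop :=
  (∀ j, 0 < M j) ∧ M 0 = 1 ∧ Monotone M ∧
  (∀ j : ℕ, M (j + 1) * M (j + 1) ≤ M j * M (j + 2)) ∧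
  1 ≤ A ∧
  (∀ j k : ℕ, M (j + k) ≤ A ^ (j + k) * (M j * M k)) ∧
  (∀ ℓ N : ℕ, ∑ j ∈ Finset.range N,
      M (ℓ + j) / (((ℓ + j : ℕ) + 1 : ℝ) * M (ℓ + j + 1)) ≤ A * (M ℓ / M (ℓ + 1)))

def StronglyRegular (M : ℕ → ℝ) : Prop := ∃ A : ℝ, StronglyRegularWith M A

noncomputable def hfn (M : ℕ → ℝ) (t : ℝ) : ℝ :=
  if t = 0 then 0 else ⨅ j : ℕ, t ^ j * M j

def PropertyP (M : ℕ → ℝ) (γ : ℝ) : Prop :=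
  ∃ (m' : ℕ → ℝ) (a : ℝ), 1 ≤ a ∧ (∀ j, 0 < m' j) ∧
    (Monotone fun j : ℕ => ((j : ℝ) + 1) ^ (-γ) * m' j) ∧
    (∀ j : ℕ, a⁻¹ * (M (j + 1) / M j) ≤ m' j ∧ m' j ≤ a * (M (j + 1) / M j))

noncomputable def growthIndex (M : ℕ → ℝ) : ℝ :=
  sSup {γ : ℝ | 0 < γ ∧ PropertyP M γ}

def Sector (γ : ℝ) : Set ℂ :=
  {z : ℂ | z ≠ 0 ∧ |Complex.arg z| < γ * Real.pi / 2}

noncomputable def mixedPartial {n : ℕ} {F : Type*} [NormedAddCommGroup F] [NormedSpace ℝ F]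
    (S : Set (EuclideanSpace ℝ (Fin n))) (f : EuclideanSpace ℝ (Fin n) → F)
    (k : ℕ) (e : Fin k → Fin n) (x : EuclideanSpace ℝ (Fin n)) : F :=
  iteratedFDerivWithin ℝ k f S x fun i => EuclideanSpace.single (e i) 1

theorem PropertyP.rpow {M : ℕ → ℝ} (hM : ∀ j, 0 < M j) {γ s : ℝ} (hs : 0 < s)
    (h : PropertyP M γ) : PropertyP (fun j => M j ^ s) (s * γ) := by
  obtain ⟨m', a, ha, hpos, hmono, hb⟩ := h
  have ha0 : 0 < a := by linarith
  refine ⟨fun j => m' j ^ s, a ^ s, Real.one_le_rpow ha hs.le,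
    fun j => Real.rpow_pos_of_pos (hpos j) s, ?_, fun j => ?_⟩
  · have key : ∀ j : ℕ, ((j : ℝ) + 1) ^ (-(s * γ)) * m' j ^ s =
        (((j : ℝ) + 1) ^ (-γ) * m' j) ^ s := fun j => by
      rw [Real.mul_rpow (by positivity) (hpos j).le, ← Real.rpow_mul (by positivity)]
      congr 2
      ring
    intro i j hij
    simp only [key]
    have := hpos i
    exact Real.rpow_le_rpow (by positivity) (hmono hij) hs.le
  · have hq : 0 < M (j + 1) / M j := div_pos (hM _) (hM _)
    have hquot : M (j + 1) ^ s / M j ^ s = (M (j + 1) / M j) ^ s :=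
      (Real.div_rpow (hM _).le (hM _).le s).symm
    simp only [hquot]
    constructor
    · rw [← Real.inv_rpow ha0.le, ← Real.mul_rpow (by positivity) hq.le]
      exact Real.rpow_le_rpow (by positivity) (hb j).1 hs.le
    · rw [← Real.mul_rpow ha0.le hq.le]
      exact Real.rpow_le_rpow (hpos j).le (hb j).2 hs.le

theorem propertyP_rpow_iff {M : ℕ → ℝ} (hM : ∀ j, 0 < M j) {γ s : ℝ} (hs : 0 < s) :
    PropertyP (fun j => M j ^ s) (s * γ) ↔ PropertyP M γ := by
  refine ⟨fun h => ?_, PropertyP.rpow hM hs⟩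
  have h' := h.rpow (fun j => Real.rpow_pos_of_pos (hM j) s) (inv_pos.2 hs)
  simpa only [Real.rpow_rpow_inv (hM _).le hs.ne', inv_mul_cancel_left₀ hs.ne'] using h'

open scoped Pointwise in
/-- for strongly regular `M` and real `s > 0`,
`γ(M^s) = s ⬝ γ(M)`. -/
theorem stmt7 (M : ℕ → ℝ) (hM : StronglyRegular M) (s : ℝ) (hs : 0 < s) :
    growthIndex (fun j => M j ^ s) = s * growthIndex M := by
  obtain ⟨A, hpos, -⟩ := hM
  unfold growthIndex
  rw [← smul_eq_mul, ← Real.sSup_smul_of_nonneg hs.le]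
  congr 1
  ext γ
  rw [Set.mem_smul_set_iff_inv_smul_mem₀ hs.ne', smul_eq_mul, Set.mem_ofPred_eq, Set.mem_ofPred_eq,
    ← propertyP_rpow_iff hpos hs, mul_inv_cancel_left₀ hs.ne', mul_pos_iff_of_pos_left (inv_pos.2 hs)]
end
end

section
/- Let N = (N_j)_{j≥0} be a strongly regular sequence with growth index γ(N) > 1. Then there exist real constants b₁ > 0 and b₂ such that for every real u > 0, ∫₀¹ log h_N(s·u) ds ≥ log h_N(b₁·u) + b₂. -/
noncomputable section

open Filter MeasureTheory
open scoped Topology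

theorem PropertyP.rpow_mul_quotient_le {N : ℕ → ℝ} {γ : ℝ}
    (h : PropertyP N γ) :
    ∃ A : ℝ, 0 < A ∧ ∀ k i : ℕ, k ≤ i →
      ((i : ℝ) + 1) ^ γ * (N (k + 1) / N k) ≤ A * ((k : ℝ) + 1) ^ γ * (N (i + 1) / N i) := by
  obtain ⟨m', a, ha, -, hmono, hm⟩ := h
  have ha0 : 0 < a := by linarith
  refine ⟨a * a, by positivity, fun k i hki => ?_⟩
  have hk : 0 < ((k : ℝ) + 1) ^ γ := by positivity
  have hi : 0 < ((i : ℝ) + 1) ^ γ := by positivity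
  have h1 := hmono hki
  simp only [Real.rpow_neg (by positivity : (0 : ℝ) ≤ (k : ℝ) + 1),
    Real.rpow_neg (by positivity : (0 : ℝ) ≤ (i : ℝ) + 1)] at h1
  rw [inv_mul_eq_div, inv_mul_eq_div, div_le_div_iff₀ hk hi] at h1
  have h2 : N (k + 1) / N k ≤ a * m' k := by
    have := (hm k).1
    rwa [inv_mul_le_iff₀ ha0] at this
  calc ((i : ℝ) + 1) ^ γ * (N (k + 1) / N k) ≤ ((i : ℝ) + 1) ^ γ * (a * m' k) := by gcongr
    _ = a * (m' k * ((i : ℝ) + 1) ^ γ) := by ring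
    _ ≤ a * (m' i * ((k : ℝ) + 1) ^ γ) := by gcongr
    _ ≤ a * (a * (N (i + 1) / N i) * ((k : ℝ) + 1) ^ γ) := by
      gcongr
      exact (hm i).2
    _ = _ := by ring

theorem hfn_le {N : ℕ → ℝ} (hN : ∀ j, 0 < N j) {t : ℝ} (ht : 0 < t) (j : ℕ) :
    hfn N t ≤ t ^ j * N j := by
  rw [hfn, if_neg ht.ne']
  refine ciInf_le ⟨0, ?_⟩ j
  rintro _ ⟨i, rfl⟩
  have := hN i
  positivity

theorem le_hfn {N : ℕ → ℝ} {t c : ℝ} (ht : 0 < t) (h : ∀ j, c ≤ t ^ j * N j) : c ≤ hfn N t := by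
  rw [hfn, if_neg ht.ne']
  exact le_ciInf h

/-- Beyond the index `k`, growth of order `γ` of the quotients limits how far the terms
`t ^ j * N j` can drop below `t ^ k * N k`. -/
theorem pow_mul_le_mul_exp {N : ℕ → ℝ} (hN : ∀ j, 0 < N j) {γ A : ℝ} (hγ : 0 < γ) (hA : 0 < A)
    (hq : ∀ k i : ℕ, k ≤ i →
      ((i : ℝ) + 1) ^ γ * (N (k + 1) / N k) ≤ A * ((k : ℝ) + 1) ^ γ * (N (i + 1) / N i))
    {t y : ℝ} (ht : 0 < t) (hy : 0 < y) {k : ℕ} (hk : A ≤ t * (N (k + 1) / N k) * y ^ γ) (n : ℕ) :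
    t ^ k * N k ≤ t ^ (k + n) * N (k + n) * Real.exp (γ * ((k + 1) * y)) := by
  have key : ∀ n : ℕ, (n.factorial : ℝ) ^ γ * (t ^ k * N k) ≤
      t ^ (k + n) * N (k + n) * (((k + 1) * y) ^ n) ^ γ := by
    intro n
    induction n with
    | zero => simp
    | succ n ih =>
      have hNk := hN k
      have hNkn := hN (k + n)
      have hstep : ((n : ℝ) + 1) ^ γ ≤
          t * (N (k + n + 1) / N (k + n)) * (((k : ℝ) + 1) * y) ^ γ := by
        have h1 := hq k (k + n) (Nat.le_add_right _ _)
        have h2 : ((n : ℝ) + 1) ^ γ ≤ (((k + n : ℕ) : ℝ) + 1) ^ γ := by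
          apply Real.rpow_le_rpow (by positivity) _ hγ.le
          push_cast
          linarith [Nat.cast_nonneg (α := ℝ) k]
        have h3 : 0 < t * y ^ γ := by positivity
        refine h2.trans (le_of_mul_le_mul_left ?_ hA)
        rw [Real.mul_rpow (by positivity) hy.le]
        calc A * (((k + n : ℕ) : ℝ) + 1) ^ γ
            ≤ (t * (N (k + 1) / N k) * y ^ γ) * (((k + n : ℕ) : ℝ) + 1) ^ γ := by gcongr
          _ = t * y ^ γ * ((((k + n : ℕ) : ℝ) + 1) ^ γ * (N (k + 1) / N k)) := by ring
          _ ≤ t * y ^ γ * (A * ((k : ℝ) + 1) ^ γ * (N (k + n + 1) / N (k + n))) := by gcongr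
          _ = _ := by ring
      rw [Nat.factorial_succ, pow_succ (((k : ℝ) + 1) * y)]
      push_cast
      rw [Real.mul_rpow (by positivity) (by positivity),
        Real.mul_rpow (by positivity) (by positivity)]
      calc ((n : ℝ) + 1) ^ γ * (n.factorial : ℝ) ^ γ * (t ^ k * N k)
          = ((n : ℝ) + 1) ^ γ * ((n.factorial : ℝ) ^ γ * (t ^ k * N k)) := by ring
        _ ≤ (t * (N (k + n + 1) / N (k + n)) * (((k : ℝ) + 1) * y) ^ γ) *
            (t ^ (k + n) * N (k + n) * (((k + 1) * y) ^ n) ^ γ) :=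
          mul_le_mul hstep ih (by positivity) ((by positivity : (0 : ℝ) ≤ _).trans hstep)
        _ = t ^ (k + (n + 1)) * N (k + (n + 1)) *
            ((((k + 1) * y) ^ n) ^ γ * (((k : ℝ) + 1) * y) ^ γ) := by
          rw [← add_assoc, pow_succ t]
          field_simp
  have hfac : (0 : ℝ) < n.factorial := by exact_mod_cast n.factorial_pos
  have hexp : ((((k : ℝ) + 1) * y) ^ n) ^ γ ≤
      (n.factorial : ℝ) ^ γ * Real.exp (γ * ((k + 1) * y)) := by
    have h := Real.pow_div_factorial_le_exp (((k : ℝ) + 1) * y) (by positivity) n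
    rw [div_le_iff₀ hfac, mul_comm (Real.exp _)] at h
    calc ((((k : ℝ) + 1) * y) ^ n) ^ γ
        ≤ ((n.factorial : ℝ) * Real.exp ((k + 1) * y)) ^ γ :=
          Real.rpow_le_rpow (by positivity) h hγ.le
      _ = _ := by
        rw [Real.mul_rpow hfac.le (Real.exp_pos _).le, ← Real.exp_mul, mul_comm γ]
  have hNkn := hN (k + n)
  refine le_of_mul_le_mul_left ?_ (by positivity : 0 < (n.factorial : ℝ) ^ γ)
  calc _ ≤ _ := key n
    _ ≤ t ^ (k + n) * N (k + n) * ((n.factorial : ℝ) ^ γ * Real.exp (γ * ((k + 1) * y))) := by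
      gcongr
    _ = _ := by ring

theorem pow_mul_le_of_quotient_le_one {N : ℕ → ℝ} (hN : ∀ j, 0 < N j) {t : ℝ} (ht : 0 < t)
    {k : ℕ} (hk : ∀ i < k, t * (N (i + 1) / N i) ≤ 1) {j : ℕ} (hj : j ≤ k) :
    t ^ k * N k ≤ t ^ j * N j := by
  induction k, hj using Nat.le_induction with
  | base => exact le_rfl
  | succ k _ ih =>
    refine le_trans ?_ (ih fun i hi => hk i (by omega))
    have hNk := hN k
    calc t ^ (k + 1) * N (k + 1) = t ^ k * N k * (t * (N (k + 1) / N k)) := by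
          rw [pow_succ]
          field_simp
      _ ≤ t ^ k * N k * 1 := by
          gcongr
          exact hk k (by omega)
      _ = t ^ k * N k := mul_one _

theorem exists_one_le_mul_quotient {N : ℕ → ℝ} (hN : ∀ j, 0 < N j) {γ A : ℝ} (hγ : 0 < γ)
    (hA : 0 < A)
    (hq : ∀ k i : ℕ, k ≤ i →
      ((i : ℝ) + 1) ^ γ * (N (k + 1) / N k) ≤ A * ((k : ℝ) + 1) ^ γ * (N (i + 1) / N i))
    {u : ℝ} (hu : 0 < u) : ∃ k, 1 ≤ u * (N (k + 1) / N k) := by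
  have hN0 := hN 0
  have hN1 := hN 1
  have hlim : Tendsto (fun i : ℕ => ((i : ℝ) + 1) ^ γ) atTop atTop :=
    (tendsto_rpow_atTop hγ).comp (tendsto_atTop_add_const_right _ _ tendsto_natCast_atTop_atTop)
  obtain ⟨i, hi⟩ := (hlim.eventually_ge_atTop (A / (u * (N 1 / N 0)))).exists
  refine ⟨i, le_of_mul_le_mul_left ?_ hA⟩
  have h := hq 0 i (Nat.zero_le _)
  simp only [Nat.cast_zero, zero_add, Real.one_rpow, mul_one] at h
  rw [div_le_iff₀ (by positivity)] at hi
  calc A * 1 ≤ ((i : ℝ) + 1) ^ γ * (u * (N 1 / N 0)) := by linarith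
    _ = u * (((i : ℝ) + 1) ^ γ * (N 1 / N 0)) := by ring
    _ ≤ u * (A * (N (i + 1) / N i)) := by gcongr
    _ = _ := by ring

theorem exists_propertyP_of_lt_growthIndex {N : ℕ → ℝ} {c : ℝ} (hc : 0 ≤ c)
    (h : c < growthIndex N) : ∃ γ, c < γ ∧ PropertyP N γ := by
  have hne : {γ : ℝ | 0 < γ ∧ PropertyP N γ}.Nonempty := by
    by_contra hne
    rw [Set.not_nonempty_iff_eq_empty] at hne
    rw [growthIndex, hne, Real.sSup_empty] at h
    linarith
  obtain ⟨γ, hγ, hlt⟩ := exists_lt_of_lt_csSup hne h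
  exact ⟨γ, hlt, hγ.2⟩

/-- for strongly regular `N` with `γ(N) > 1` there are constants `b₁ > 0`
and `b₂ ∈ ℝ` such that `∫₀¹ log h_N(s u) ds ≥ log h_N(b₁ u) + b₂` for every `u > 0`. -/
theorem stmt9 (N : ℕ → ℝ) (hN : StronglyRegular N) (hγ : 1 < growthIndex N) :
    ∃ b₁ b₂ : ℝ, 0 < b₁ ∧ ∀ u : ℝ, 0 < u →
      Real.log (hfn N (b₁ * u)) + b₂ ≤ ∫ s in (0:ℝ)..1, Real.log (hfn N (s * u)) := by
  obtain ⟨_, hpos, hN0, -⟩ := hN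
  obtain ⟨γ, hγ1, hP⟩ := exists_propertyP_of_lt_growthIndex zero_le_one hγ
  obtain ⟨A, hA, hq⟩ := hP.rpow_mul_quotient_le
  have hγ0 : 0 < γ := by linarith
  have hγinv : γ⁻¹ < 1 := inv_lt_one_of_one_lt₀ hγ1
  set B : ℝ := γ * A ^ γ⁻¹ with hB
  have hB0 : 0 < B := by positivity
  set D : ℝ := 1 + B / (1 - γ⁻¹) with hD
  have hD1 : 1 ≤ D := by
    have : 0 < B / (1 - γ⁻¹) := div_pos hB0 (by linarith)
    linarith
  -- A uniform lower bound for `h_N`, valid as soon as `u` lies between consecutive quotients.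
  have lower : ∀ u : ℝ, 0 < u → ∃ k : ℕ, ∀ s : ℝ, 0 < s → s ≤ 1 →
      (s * u) ^ k * N k * Real.exp (-((k + 1) * (B * s ^ (-γ⁻¹)))) ≤ hfn N (s * u) := by
    intro u hu
    have hex := exists_one_le_mul_quotient hpos hγ0 hA hq hu
    classical
    refine ⟨Nat.find hex, fun s hs hs1 => ?_⟩
    set k := Nat.find hex
    have hsu : 0 < s * u := by positivity
    have hy : 0 < A ^ γ⁻¹ * s ^ (-γ⁻¹) := by positivity
    have hNk := hpos k
    have hyγ : (A ^ γ⁻¹ * s ^ (-γ⁻¹)) ^ γ = A * s⁻¹ := by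
      rw [Real.mul_rpow (by positivity) (by positivity), ← Real.rpow_mul hA.le,
        ← Real.rpow_mul hs.le, neg_mul, inv_mul_cancel₀ hγ0.ne', Real.rpow_one, Real.rpow_neg_one]
    have hAk : A ≤ s * u * (N (k + 1) / N k) * (A ^ γ⁻¹ * s ^ (-γ⁻¹)) ^ γ := by
      rw [hyγ]
      calc A = A * 1 := (mul_one A).symm
        _ ≤ A * (u * (N (k + 1) / N k)) := by
          gcongr
          exact Nat.find_spec hex
        _ = _ := by field_simp
    have hsmall : ∀ i < k, s * u * (N (i + 1) / N i) ≤ 1 := by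
      intro i hi
      have h1 := not_le.mp (Nat.find_min hex hi)
      have := hpos i
      have := hpos (i + 1)
      calc s * u * (N (i + 1) / N i) = s * (u * (N (i + 1) / N i)) := by ring
        _ ≤ 1 * 1 := by gcongr
        _ = 1 := one_mul 1
    refine le_hfn hsu fun j => ?_
    rw [Real.exp_neg, ← div_eq_mul_inv, div_le_iff₀ (Real.exp_pos _)]
    rcases le_total j k with hj | hj
    · refine (pow_mul_le_of_quotient_le_one hpos hsu hsmall hj).trans ?_
      have := hpos j
      exact le_mul_of_one_le_right (by positivity) (Real.one_le_exp (by positivity))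
    · obtain ⟨n, rfl⟩ := Nat.exists_eq_add_of_le hj
      refine (pow_mul_le_mul_exp hpos hγ0 hA hq hsu hy hAk n).trans_eq ?_
      congr 2
      rw [hB]
      ring
  have hfn_pos : ∀ u : ℝ, 0 < u → 0 < hfn N u := by
    intro u hu
    obtain ⟨k, hk⟩ := lower u hu
    have h := hk 1 one_pos le_rfl
    have := hpos k
    rw [one_mul] at h
    exact lt_of_lt_of_le (by positivity) h
  refine ⟨Real.exp (-D), -D, Real.exp_pos _, fun u hu => ?_⟩
  have hbu : 0 < Real.exp (-D) * u := by positivity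
  by_cases hint : IntervalIntegrable (fun s => Real.log (hfn N (s * u))) volume 0 1
  swap
  · rw [intervalIntegral.integral_undef hint]
    have h := Real.log_nonpos (hfn_pos _ hbu).le (by simpa [hN0] using hfn_le hpos hbu 0)
    linarith
  obtain ⟨k, hk⟩ := lower u hu
  have hNk := hpos k
  have hupper : Real.log (hfn N (Real.exp (-D) * u)) ≤
      k * (-D) + (k * Real.log u + Real.log (N k)) := by
    refine (Real.log_le_log (hfn_pos _ hbu) (hfn_le hpos hbu k)).trans_eq ?_
    rw [Real.log_mul (by positivity) hNk.ne', Real.log_pow,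
      Real.log_mul (Real.exp_pos _).ne' hu.ne', Real.log_exp]
    ring
  have hint1 : IntervalIntegrable (fun s : ℝ => (k : ℝ) * Real.log s) volume 0 1 :=
    intervalIntegral.intervalIntegrable_log'.const_mul _
  have hint2 : IntervalIntegrable (fun _ : ℝ => k * Real.log u + Real.log (N k)) volume 0 1 :=
    intervalIntegrable_const
  have hint3 : IntervalIntegrable (fun s : ℝ => ((k : ℝ) + 1) * (B * s ^ (-γ⁻¹))) volume 0 1 :=
    ((intervalIntegral.intervalIntegrable_rpow' (by linarith)).const_mul _).const_mul _
  have hmono : ∫ s in (0:ℝ)..1, (k * Real.log s + (k * Real.log u + Real.log (N k)) -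
      (k + 1) * (B * s ^ (-γ⁻¹))) ≤ ∫ s in (0:ℝ)..1, Real.log (hfn N (s * u)) := by
    refine intervalIntegral.integral_mono_on_of_le_Ioo zero_le_one
      ((hint1.add hint2).sub hint3) hint fun s hs => ?_
    have hs0 : 0 < s := hs.1
    have h := Real.log_le_log (by positivity) (hk s hs0 hs.2.le)
    rw [Real.log_mul (by positivity) (Real.exp_pos _).ne', Real.log_exp,
      Real.log_mul (by positivity) hNk.ne', Real.log_pow, Real.log_mul hs0.ne' hu.ne'] at h
    linarith
  have hval : ∫ s in (0:ℝ)..1, (k * Real.log s + (k * Real.log u + Real.log (N k)) -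
      (k + 1) * (B * s ^ (-γ⁻¹))) =
      -k + (k * Real.log u + Real.log (N k)) - (k + 1) * (B / (1 - γ⁻¹)) := by
    rw [intervalIntegral.integral_sub (hint1.add hint2) hint3,
      intervalIntegral.integral_add hint1 hint2, intervalIntegral.integral_const_mul,
      intervalIntegral.integral_const_mul, intervalIntegral.integral_const_mul,
      integral_rpow (Or.inl (by linarith)), integral_log, intervalIntegral.integral_const]
    rw [Real.one_rpow, Real.zero_rpow (by linarith), neg_add_eq_sub]
    simp [div_eq_mul_inv]
  rw [hval] at hmono
  refine le_trans ?_ hmono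
  have : B / (1 - γ⁻¹) = D - 1 := by rw [hD]; ring
  rw [this]
  nlinarith
end
end
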